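/- Let 0 < a, b < min{c,1} and c ≤ a+b. Then the function f₁(r) = (𝕂_{a,b,c}(r) − 𝔼_{a,b,c}(r))/(r²·𝕂_{a,b,c}(r)) is strictly increasing on (0,1), with f₁(r) → b/c as r → 0+ and f₁(r) → 1 as r → 1−. In particular, the sharp inequality b/c < (𝕂_{a,b,c}(r) − 𝔼_{a,b,c}(r))/(r²·𝕂_{a,b,c}(r)) < 1 holds for all r ∈ (0,1). -/

import Mathlib

open Filter Set

/-- Shifted factorial (Appell symbol) `(a,n) = a(a+1)⋯(a+n−1)`, with `(a,0)=1`. -/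
noncomputable def shiftedFact (a : ℝ) (n : ℕ) : ℝ := ∏ i ∈ Finset.range n, (a + i)

/-- Gaussian hypergeometric function `F(a,b;c;x)` as a real power series. -/
noncomputable def hypF (a b c x : ℝ) : ℝ :=
  ∑' n : ℕ, (shiftedFact a n * shiftedFact b n / (shiftedFact c n * (n.factorial : ℝ))) * x ^ n

/-- Beta function `B(x,y) = Γ(x)Γ(y)/Γ(x+y)`. -/
noncomputable def betaR (x y : ℝ) : ℝ := Real.Gamma x * Real.Gamma y / Real.Gamma (x + y)

/-- Generalized complete elliptic integral of the first kind `𝕂_{a,b,c}(r)`. -/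
noncomputable def Kg (a b c r : ℝ) : ℝ := betaR a b / 2 * hypF a b c (r ^ 2)

/-- Generalized complete elliptic integral of the second kind `𝔼_{a,b,c}(r)`. -/
noncomputable def Eg (a b c r : ℝ) : ℝ := betaR a b / 2 * hypF (a - 1) b c (r ^ 2)

theorem summable_mul_pow_of_abs_le_one {u : ℕ → ℝ} (hu : ∀ n, |u n| ≤ 1) {x : ℝ}
    (hx : x ∈ Set.Ioo (0 : ℝ) 1) : Summable fun n => u n * x ^ n := by
  refine Summable.of_norm_bounded (summable_geometric_of_lt_one hx.1.le hx.2) fun n => ?_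
  rw [Real.norm_eq_abs, abs_mul, abs_of_nonneg (pow_nonneg hx.1.le n)]
  exact mul_le_of_le_one_left (pow_nonneg hx.1.le n) (hu n)

/-- The quotient of the power series with coefficients `A n * t n` and `A n`. -/
noncomputable def seriesRatio (A t : ℕ → ℝ) (x : ℝ) : ℝ :=
  (∑' n, A n * t n * x ^ n) / ∑' n, A n * x ^ n

section SeriesRatio

variable {A t : ℕ → ℝ}

theorem summable_weighted (hA : ∀ n, 0 < A n) (hA1 : ∀ n, A n ≤ 1) (ht0 : ∀ n, 0 < t n)
    (ht1 : ∀ n, t n < 1) {x : ℝ} (hx : x ∈ Set.Ioo (0 : ℝ) 1) :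
    Summable fun n => A n * t n * x ^ n := by
  refine summable_mul_pow_of_abs_le_one (fun n => ?_) hx
  rw [abs_of_pos (mul_pos (hA n) (ht0 n))]
  exact mul_le_one₀ (hA1 n) (ht0 n).le (ht1 n).le

theorem summable_coeff (hA : ∀ n, 0 < A n) (hA1 : ∀ n, A n ≤ 1) {x : ℝ}
    (hx : x ∈ Set.Ioo (0 : ℝ) 1) : Summable fun n => A n * x ^ n :=
  summable_mul_pow_of_abs_le_one (fun n => by rw [abs_of_pos (hA n)]; exact hA1 n) hx

theorem tsum_coeff_pos (hA : ∀ n, 0 < A n) (hA1 : ∀ n, A n ≤ 1) {x : ℝ}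
    (hx : x ∈ Set.Ioo (0 : ℝ) 1) : 0 < ∑' n, A n * x ^ n :=
  (summable_coeff hA hA1 hx).tsum_pos (fun n => (mul_pos (hA n) (pow_pos hx.1 n)).le) 0
    (mul_pos (hA 0) (pow_pos hx.1 0))

theorem hasSum_weighted_sub (hA : ∀ n, 0 < A n) (hA1 : ∀ n, A n ≤ 1) (ht0 : ∀ n, 0 < t n)
    (ht1 : ∀ n, t n < 1) {x : ℝ} (hx : x ∈ Set.Ioo (0 : ℝ) 1) (T : ℝ) :
    HasSum (fun n => A n * (t n - T) * x ^ n)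
      ((seriesRatio A t x - T) * ∑' n, A n * x ^ n) := by
  have h := (summable_weighted hA hA1 ht0 ht1 hx).hasSum.sub
    ((summable_coeff hA hA1 hx).hasSum.mul_left T)
  have hval : (seriesRatio A t x - T) * ∑' n, A n * x ^ n =
      ∑' n, A n * t n * x ^ n - T * ∑' n, A n * x ^ n := by
    rw [sub_mul, seriesRatio, div_mul_cancel₀ _ (tsum_coeff_pos hA hA1 hx).ne']
  have hterm : ∀ n, A n * (t n - T) * x ^ n = A n * t n * x ^ n - T * (A n * x ^ n) :=
    fun n => by ring
  simpa only [hval, hterm] using h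

theorem seriesRatio_lt_one (hA : ∀ n, 0 < A n) (hA1 : ∀ n, A n ≤ 1) (ht0 : ∀ n, 0 < t n)
    (ht1 : ∀ n, t n < 1) {x : ℝ} (hx : x ∈ Set.Ioo (0 : ℝ) 1) : seriesRatio A t x < 1 := by
  rw [seriesRatio, div_lt_one (tsum_coeff_pos hA hA1 hx)]
  have key : ∀ n, A n * t n * x ^ n < A n * x ^ n := fun n =>
    mul_lt_mul_of_pos_right (mul_lt_of_lt_one_right (hA n) (ht1 n)) (pow_pos hx.1 n)
  exact Summable.tsum_lt_tsum (fun n => (key n).le) (key 0)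
    (summable_weighted hA hA1 ht0 ht1 hx) (summable_coeff hA hA1 hx)

theorem lt_seriesRatio (hA : ∀ n, 0 < A n) (hA1 : ∀ n, A n ≤ 1) (ht0 : ∀ n, 0 < t n)
    (ht1 : ∀ n, t n < 1) (ht : StrictMono t) {x : ℝ} (hx : x ∈ Set.Ioo (0 : ℝ) 1) :
    t 0 < seriesRatio A t x := by
  have h := hasSum_weighted_sub hA hA1 ht0 ht1 hx (t 0)
  have hpos := h.summable.tsum_pos (fun n => mul_nonneg (mul_nonneg (hA n).le
      (sub_nonneg.2 (ht.monotone n.zero_le))) (pow_pos hx.1 n).le) 1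
    (mul_pos (mul_pos (hA 1) (sub_pos.2 (ht one_pos))) (pow_pos hx.1 1))
  rw [h.tsum_eq] at hpos
  exact sub_pos.1 (pos_of_mul_pos_left hpos (tsum_coeff_pos hA hA1 hx).le)

theorem strictMonoOn_seriesRatio (hA : ∀ n, 0 < A n) (hA1 : ∀ n, A n ≤ 1) (ht0 : ∀ n, 0 < t n)
    (ht1 : ∀ n, t n < 1) (ht : StrictMono t) (htl : Tendsto t atTop (nhds 1)) :
    StrictMonoOn (seriesRatio A t) (Set.Ioo 0 1) := by
  intro x hx y hy hxy
  set T := seriesRatio A t x with hT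
  have hex : ∃ n, T < t n :=
    (htl.eventually_const_lt (seriesRatio_lt_one hA hA1 ht0 ht1 hx)).exists
  classical
  obtain ⟨N, hN, hlt⟩ : ∃ N, T < t N ∧ ∀ n < N, t n ≤ T :=
    ⟨Nat.find hex, Nat.find_spec hex, fun n hn => not_lt.1 (Nat.find_min hex hn)⟩
  set q := y / x with hq
  have hq1 : 1 < q := (one_lt_div hx.1).2 hxy
  have hy' : y = q * x := by rw [hq, div_mul_cancel₀ _ hx.1.ne']
  have h1 := (hasSum_weighted_sub hA hA1 ht0 ht1 hx T).mul_left (q ^ N)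
  have h2 := hasSum_weighted_sub hA hA1 ht0 ht1 hy T
  have h := h2.sub h1
  have hterm : ∀ n, A n * (t n - T) * y ^ n - q ^ N * (A n * (t n - T) * x ^ n)
      = A n * x ^ n * ((t n - T) * (q ^ n - q ^ N)) := by
    intro n; rw [hy', mul_pow]; ring
  simp only [hterm, ← hT, sub_self, zero_mul, mul_zero, sub_zero] at h
  have hpos := h.summable.tsum_pos (fun n => ?_) (N + 1) ?_
  · rw [h.tsum_eq] at hpos
    exact sub_pos.1 (pos_of_mul_pos_left hpos (tsum_coeff_pos hA hA1 hy).le)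
  · refine mul_nonneg (mul_pos (hA n) (pow_pos hx.1 n)).le ?_
    rcases lt_or_ge n N with hn | hn
    · exact mul_nonneg_of_nonpos_of_nonpos (sub_nonpos.2 (hlt n hn))
        (sub_nonpos.2 (pow_le_pow_right₀ hq1.le hn.le))
    · exact mul_nonneg (sub_nonneg.2 (hN.le.trans (ht.monotone hn)))
        (sub_nonneg.2 (pow_le_pow_right₀ hq1.le hn))
  · exact mul_pos (mul_pos (hA _) (pow_pos hx.1 _))
      (mul_pos (sub_pos.2 (hN.trans (ht N.lt_succ_self)))
        (sub_pos.2 (pow_lt_pow_right₀ hq1 N.lt_succ_self)))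

theorem seriesRatio_sub_le (hA : ∀ n, 0 < A n) (hA1 : ∀ n, A n ≤ 1) (ht0 : ∀ n, 0 < t n)
    (ht1 : ∀ n, t n < 1) (ht : StrictMono t) (hA0 : A 0 = 1) {x : ℝ}
    (hx : x ∈ Set.Ioo (0 : ℝ) 1) : seriesRatio A t x ≤ t 0 + x / (1 - x) := by
  have h := hasSum_weighted_sub hA hA1 ht0 ht1 hx (t 0)
  have hF : 1 ≤ ∑' n, A n * x ^ n := by
    simpa [hA0] using (summable_coeff hA hA1 hx).le_tsum 0
      (fun n _ => (mul_pos (hA n) (pow_pos hx.1 n)).le)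
  have hle : ∑' n, A n * (t n - t 0) * x ^ n ≤ x / (1 - x) := by
    rw [h.summable.tsum_eq_zero_add]
    have hg := (hasSum_geometric_of_lt_one hx.1.le hx.2).mul_left x
    rw [div_eq_mul_inv, ← hg.tsum_eq]
    simp only [sub_self, mul_zero, zero_mul, zero_add]
    refine Summable.tsum_le_tsum (fun n => ?_) ((summable_nat_add_iff 1).2 h.summable) hg.summable
    rw [pow_succ']
    refine (mul_le_mul_of_nonneg_right ?_ (mul_nonneg hx.1.le (pow_nonneg hx.1.le n))).trans_eq (one_mul _)
    exact mul_le_one₀ (hA1 _) (sub_nonneg.2 (ht.monotone (Nat.zero_le _)))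
      (by linarith [ht1 (n + 1), ht0 0])
  rw [h.tsum_eq] at hle
  have h0 := sub_pos.2 (lt_seriesRatio hA hA1 ht0 ht1 ht hx)
  linarith [le_mul_of_one_le_right h0.le hF]

theorem tendsto_seriesRatio_zero (hA : ∀ n, 0 < A n) (hA1 : ∀ n, A n ≤ 1) (ht0 : ∀ n, 0 < t n)
    (ht1 : ∀ n, t n < 1) (ht : StrictMono t) (hA0 : A 0 = 1) :
    Tendsto (seriesRatio A t) (nhdsWithin 0 (Set.Ioi 0)) (nhds (t 0)) := by
  have hev : ∀ᶠ x in nhdsWithin (0 : ℝ) (Set.Ioi 0), x ∈ Set.Ioo (0 : ℝ) 1 :=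
    Ioo_mem_nhdsGT one_pos
  have hlim : Tendsto (fun x : ℝ => t 0 + x / (1 - x)) (nhdsWithin 0 (Set.Ioi 0))
      (nhds (t 0)) := by
    have hc : ContinuousAt (fun x : ℝ => t 0 + x / (1 - x)) 0 :=
      continuousAt_const.add (continuousAt_id.div (continuousAt_const.sub continuousAt_id)
        (by norm_num))
    simpa using hc.tendsto.mono_left nhdsWithin_le_nhds
  refine tendsto_of_tendsto_of_tendsto_of_le_of_le' tendsto_const_nhds hlim ?_ ?_
  · filter_upwards [hev] with x hx using (lt_seriesRatio hA hA1 ht0 ht1 ht hx).le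
  · filter_upwards [hev] with x hx using seriesRatio_sub_le hA hA1 ht0 ht1 ht hA0 hx

theorem tendsto_tsum_coeff_atTop (hA : ∀ n, 0 < A n) (hA1 : ∀ n, A n ≤ 1)
    (hdiv : ¬ Summable A) :
    Tendsto (fun x => ∑' n, A n * x ^ n) (nhdsWithin 1 (Set.Iio 1)) atTop := by
  refine tendsto_atTop.2 fun M => ?_
  have hs := (not_summable_iff_tendsto_nat_atTop_of_nonneg fun n => (hA n).le).1 hdiv
  obtain ⟨N, hN⟩ := (hs.eventually_gt_atTop M).exists
  have hc : Continuous fun x : ℝ => ∑ n ∈ Finset.range N, A n * x ^ n := by fun_prop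
  have hlt : ∀ᶠ x in nhdsWithin (1 : ℝ) (Set.Iio 1), M < ∑ n ∈ Finset.range N, A n * x ^ n :=
    (hc.tendsto 1).mono_left nhdsWithin_le_nhds |>.eventually_const_lt (by simpa using hN)
  filter_upwards [hlt, Ioo_mem_nhdsLT (zero_lt_one' ℝ)] with x hx hx01
  exact hx.le.trans ((summable_coeff hA hA1 hx01).sum_le_tsum _
    fun n _ => (mul_pos (hA n) (pow_pos hx01.1 n)).le)

theorem tendsto_seriesRatio_one (hA : ∀ n, 0 < A n) (hA1 : ∀ n, A n ≤ 1) (ht0 : ∀ n, 0 < t n)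
    (ht1 : ∀ n, t n < 1) (ht : StrictMono t) (htl : Tendsto t atTop (nhds 1))
    (hdiv : ¬ Summable A) :
    Tendsto (seriesRatio A t) (nhdsWithin 1 (Set.Iio 1)) (nhds 1) := by
  have hev : ∀ᶠ x in nhdsWithin (1 : ℝ) (Set.Iio 1), x ∈ Set.Ioo (0 : ℝ) 1 :=
    Ioo_mem_nhdsLT one_pos
  refine tendsto_order.2 ⟨fun s hs => ?_, fun s hs => ?_⟩
  · obtain ⟨s', hss', hs'⟩ := exists_between hs
    obtain ⟨N, hN⟩ := (htl.eventually_const_lt hs').exists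
    have hpos : 0 < s' - s := sub_pos.2 hss'
    filter_upwards [hev, (tendsto_tsum_coeff_atTop hA hA1 hdiv).eventually_gt_atTop
      ((∑ n ∈ Finset.range N, A n * |t n - s'|) / (s' - s))] with x hx hlarge
    rw [div_lt_iff₀ hpos] at hlarge
    have h := hasSum_weighted_sub hA hA1 ht0 ht1 hx s'
    have hF := tsum_coeff_pos hA hA1 hx
    have hpart : ∑ n ∈ Finset.range N, A n * (t n - s') * x ^ n ≤
        (seriesRatio A t x - s') * ∑' n, A n * x ^ n :=
      sum_le_hasSum _ (fun n hn => mul_nonneg (mul_nonneg (hA n).le (sub_nonneg.2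
        (hN.le.trans (ht.monotone (by simpa using hn))))) (pow_nonneg hx.1.le n)) h
    have hlow : -∑ n ∈ Finset.range N, A n * |t n - s'| ≤
        ∑ n ∈ Finset.range N, A n * (t n - s') * x ^ n := by
      rw [← Finset.sum_neg_distrib]
      refine Finset.sum_le_sum fun n _ => ?_
      refine (neg_le_neg ?_).trans (neg_abs_le _)
      rw [abs_mul, abs_mul, abs_of_pos (hA n), abs_of_nonneg (pow_nonneg hx.1.le n)]
      exact mul_le_of_le_one_right (mul_nonneg (hA n).le (abs_nonneg _))
        (pow_le_one₀ hx.1.le hx.2.le)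
    have : 0 < (seriesRatio A t x - s) * ∑' n, A n * x ^ n := by linarith
    exact sub_pos.1 (pos_of_mul_pos_left this hF.le)
  · filter_upwards [hev] with x hx using (seriesRatio_lt_one hA hA1 ht0 ht1 hx).trans hs

end SeriesRatio

theorem shiftedFact_succ (a : ℝ) (n : ℕ) :
    shiftedFact a (n + 1) = shiftedFact a n * (a + n) := by
  simp [shiftedFact, Finset.prod_range_succ]

theorem shiftedFact_sub_one_succ (a : ℝ) (n : ℕ) :
    shiftedFact (a - 1) (n + 1) = (a - 1) * shiftedFact a n := by
  simp only [shiftedFact, Finset.prod_range_succ', Nat.cast_zero, add_zero]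
  rw [mul_comm]
  congr 1
  refine Finset.prod_congr rfl fun i _ => ?_
  push_cast
  ring

theorem shiftedFact_pos {a : ℝ} (ha : 0 < a) (n : ℕ) : 0 < shiftedFact a n :=
  Finset.prod_pos fun i _ => by positivity

/-- The coefficients of the power series `hypF a b c`. -/
noncomputable def hypCoeff (a b c : ℝ) (n : ℕ) : ℝ :=
  shiftedFact a n * shiftedFact b n / (shiftedFact c n * (n.factorial : ℝ))

theorem hypCoeff_zero (a b c : ℝ) : hypCoeff a b c 0 = 1 := by
  simp [hypCoeff, shiftedFact]

theorem hypCoeff_pos {a b c : ℝ} (ha : 0 < a) (hb : 0 < b) (hc : 0 < c) (n : ℕ) :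
    0 < hypCoeff a b c n := by
  have := shiftedFact_pos ha n
  have := shiftedFact_pos hb n
  have := shiftedFact_pos hc n
  unfold hypCoeff
  positivity

theorem hypCoeff_succ (a b c : ℝ) (n : ℕ) :
    hypCoeff a b c (n + 1) = hypCoeff a b c n * ((a + n) * (b + n) / ((c + n) * (n + 1))) := by
  rw [hypCoeff, hypCoeff, shiftedFact_succ, shiftedFact_succ, shiftedFact_succ,
    Nat.factorial_succ, div_mul_div_comm]
  push_cast
  congr 1 <;> ring

theorem hypCoeff_sub_one_succ {a b c : ℝ} (hc : 0 < c) (n : ℕ) :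
    hypCoeff (a - 1) b c (n + 1) =
      hypCoeff a b c (n + 1) - hypCoeff a b c n * ((b + n) / (c + n)) := by
  have := (shiftedFact_pos hc n).ne'
  have : c + n ≠ 0 := by positivity
  have : (n.factorial : ℝ) ≠ 0 := by positivity
  simp only [hypCoeff, shiftedFact_succ b, shiftedFact_succ c, shiftedFact_succ a,
    shiftedFact_sub_one_succ, Nat.factorial_succ]
  push_cast
  field_simp
  ring

theorem hypCoeff_le_one {a b c : ℝ} (ha : 0 < a) (hb : 0 < b) (ha1 : a < 1) (hbc : b < c)
    (n : ℕ) : hypCoeff a b c n ≤ 1 := by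
  have hc := hb.trans hbc
  induction n with
  | zero => rw [hypCoeff_zero]
  | succ n ih =>
    rw [hypCoeff_succ]
    refine mul_le_one₀ ih (by positivity) ((div_le_one (by positivity)).2 ?_)
    rw [mul_comm (c + n : ℝ)]
    exact mul_le_mul (by linarith) (by linarith) (by positivity) (by positivity)

theorem not_summable_hypCoeff {a b c : ℝ} (ha : 0 < a) (hb : 0 < b) (hc : 0 < c)
    (hcab : c ≤ a + b) : ¬ Summable (hypCoeff a b c) := by
  have hlow : ∀ n : ℕ, hypCoeff a b c 1 ≤ (n + 1) * hypCoeff a b c (n + 1) := by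
    intro n
    induction n with
    | zero => simp
    | succ n ih =>
      refine ih.trans ?_
      have hA := hypCoeff_pos ha hb hc (n + 1)
      rw [hypCoeff_succ a b c (n + 1)]
      push_cast
      have key : (n + 1 : ℝ) ≤ (a + (n + 1)) * (b + (n + 1)) / (c + (n + 1)) := by
        rw [le_div_iff₀ (by positivity)]
        nlinarith [mul_pos ha hb, mul_nonneg (sub_nonneg.2 hcab) (by positivity : (0 : ℝ) ≤ n + 1)]
      calc (n + 1 : ℝ) * hypCoeff a b c (n + 1)
          ≤ (a + (n + 1)) * (b + (n + 1)) / (c + (n + 1)) * hypCoeff a b c (n + 1) :=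
            mul_le_mul_of_nonneg_right key hA.le
        _ = _ := by
          have : c + (n + 1 : ℝ) ≠ 0 := by positivity
          field_simp
  intro hs
  have h1 := hypCoeff_pos ha hb hc 1
  have hharm : Summable fun n : ℕ => 1 / ((n : ℝ) + 1) := by
    refine Summable.of_nonneg_of_le (fun n => by positivity) (fun n => ?_)
      (((summable_nat_add_iff 1).2 hs).mul_left (1 / hypCoeff a b c 1))
    rw [one_div_mul_eq_div, div_le_div_iff₀ (by positivity) h1, one_mul, mul_comm]
    exact hlow n
  refine Real.not_summable_one_div_natCast ((summable_nat_add_iff 1).1 ?_)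
  simpa using hharm

theorem hypF_sub_hypF_sub_one {a b c : ℝ} (ha : 0 < a) (hb : 0 < b) (ha1 : a < 1) (hbc : b < c)
    {x : ℝ} (hx : x ∈ Set.Ioo (0 : ℝ) 1) :
    hypF a b c x - hypF (a - 1) b c x =
      x * ∑' n : ℕ, hypCoeff a b c n * ((b + n) / (c + n)) * x ^ n := by
  have hc := hb.trans hbc
  have hS : HasSum (fun n => hypCoeff a b c n * x ^ n) (hypF a b c x) :=
    (summable_coeff (hypCoeff_pos ha hb hc) (hypCoeff_le_one ha hb ha1 hbc) hx).hasSum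
  have hG := (summable_weighted (hypCoeff_pos ha hb hc) (hypCoeff_le_one ha hb ha1 hbc)
    (t := fun n : ℕ => (b + n) / (c + n)) (fun n => by positivity)
    (fun n => (div_lt_one (by positivity)).2 (by linarith)) hx).hasSum.mul_left x
  have hE : HasSum (fun n => hypCoeff (a - 1) b c n * x ^ n)
      (hypF a b c x - x * ∑' n : ℕ, hypCoeff a b c n * ((b + n) / (c + n)) * x ^ n) := by
    rw [← hasSum_nat_add_iff' 1] at hS ⊢
    convert hS.sub hG using 1
    · ext n
      rw [hypCoeff_sub_one_succ hc]
      ring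
    · simp only [Finset.sum_range_one, hypCoeff_zero]
      ring
  rw [show hypF (a - 1) b c x = _ from hE.tsum_eq]
  ring

theorem betaR_pos {a b : ℝ} (ha : 0 < a) (hb : 0 < b) : 0 < betaR a b :=
  div_pos (mul_pos (Real.Gamma_pos_of_pos ha) (Real.Gamma_pos_of_pos hb))
    (Real.Gamma_pos_of_pos (add_pos ha hb))

theorem stmt15 (a b c : ℝ) (ha : 0 < a) (hb : 0 < b)
    (ha' : a < min c 1) (hb' : b < min c 1) (hcab : c ≤ a + b)
    (f : ℝ → ℝ)
    (hf : ∀ r, f r = (Kg a b c r - Eg a b c r) / (r ^ 2 * Kg a b c r)) :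
    StrictMonoOn f (Set.Ioo 0 1) ∧
    Tendsto f (nhdsWithin 0 (Set.Ioi 0)) (nhds (b / c)) ∧
    Tendsto f (nhdsWithin 1 (Set.Iio 1)) (nhds 1) ∧
    ∀ r ∈ Set.Ioo (0 : ℝ) 1, b / c < f r ∧ f r < 1 := by
  have ha1 := ha'.trans_le (min_le_right c 1)
  have hbc := hb'.trans_le (min_le_left c 1)
  have hc := hb.trans hbc
  set A := hypCoeff a b c
  set t : ℕ → ℝ := fun n => (b + n) / (c + n) with ht_def
  have hA : ∀ n, 0 < A n := hypCoeff_pos ha hb hc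
  have hA1 : ∀ n, A n ≤ 1 := hypCoeff_le_one ha hb ha1 hbc
  have ht0 : ∀ n, 0 < t n := fun n => by positivity
  have ht1 : ∀ n, t n < 1 := fun n => (div_lt_one (by positivity)).2 (by linarith)
  have hteq : ∀ n, t n = 1 - (c - b) / (c + n) := fun n => by
    have : c + n ≠ 0 := by positivity
    simp only [ht_def]
    field_simp
    ring
  have ht : StrictMono t := fun m n hmn => by
    rw [hteq, hteq]
    have : (m : ℝ) < n := by exact_mod_cast hmn
    exact sub_lt_sub_left (div_lt_div_of_pos_left (sub_pos.2 hbc) (by positivity)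
      (by linarith)) 1
  have htl : Tendsto t atTop (nhds 1) := by
    have h0 : Tendsto (fun n : ℕ => (c - b) / (c + n)) atTop (nhds 0) :=
      (tendsto_atTop_add_const_left _ c tendsto_natCast_atTop_atTop).const_div_atTop _
    rw [funext hteq]
    simpa using h0.const_sub 1
  have htz : t 0 = b / c := by simp [ht_def]
  have hsq : ∀ r ∈ Set.Ioo (0 : ℝ) 1, r ^ 2 ∈ Set.Ioo (0 : ℝ) 1 := fun r hr =>
    ⟨pow_pos hr.1 2, pow_lt_one₀ hr.1.le hr.2 two_ne_zero⟩
  have hfR : ∀ r ∈ Set.Ioo (0 : ℝ) 1, f r = seriesRatio A t (r ^ 2) := fun r hr => by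
    have hB := betaR_pos ha hb
    have hF : hypF a b c (r ^ 2) ≠ 0 := (tsum_coeff_pos hA hA1 (hsq r hr)).ne'
    have hr2 := (hsq r hr).1.ne'
    rw [hf, Kg, Eg, ← mul_sub, hypF_sub_hypF_sub_one ha hb ha1 hbc (hsq r hr)]
    change _ = (∑' n, A n * t n * (r ^ 2) ^ n) / hypF a b c (r ^ 2)
    rw [mul_left_comm, mul_div_mul_left _ _ hr2, mul_div_mul_left _ _ (half_pos hB).ne']
  have hev0 : ∀ᶠ r in nhdsWithin (0 : ℝ) (Set.Ioi 0), r ∈ Set.Ioo (0 : ℝ) 1 :=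
    Ioo_mem_nhdsGT one_pos
  have hev1 : ∀ᶠ r in nhdsWithin (1 : ℝ) (Set.Iio 1), r ∈ Set.Ioo (0 : ℝ) 1 :=
    Ioo_mem_nhdsLT one_pos
  have hcont : Continuous fun r : ℝ => r ^ 2 := by fun_prop
  refine ⟨fun r hr s hs hrs => ?_, ?_, ?_, fun r hr => ?_⟩
  · rw [hfR r hr, hfR s hs]
    exact strictMonoOn_seriesRatio hA hA1 ht0 ht1 ht htl (hsq r hr) (hsq s hs)
      (pow_lt_pow_left₀ hrs hr.1.le two_ne_zero)
  · rw [← htz]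
    have hs : Tendsto (fun r : ℝ => r ^ 2) (nhdsWithin 0 (Set.Ioi 0))
        (nhdsWithin 0 (Set.Ioi 0)) :=
      tendsto_nhdsWithin_iff.2 ⟨by simpa using (hcont.tendsto 0).mono_left nhdsWithin_le_nhds,
        hev0.mono fun r hr => (hsq r hr).1⟩
    exact ((tendsto_seriesRatio_zero hA hA1 ht0 ht1 ht (hypCoeff_zero a b c)).comp hs).congr'
      (hev0.mono fun r hr => (hfR r hr).symm)
  · have hs : Tendsto (fun r : ℝ => r ^ 2) (nhdsWithin 1 (Set.Iio 1))
        (nhdsWithin 1 (Set.Iio 1)) :=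
      tendsto_nhdsWithin_iff.2 ⟨by simpa using (hcont.tendsto 1).mono_left nhdsWithin_le_nhds,
        hev1.mono fun r hr => (hsq r hr).2⟩
    exact ((tendsto_seriesRatio_one hA hA1 ht0 ht1 ht htl
      (not_summable_hypCoeff ha hb hc hcab)).comp hs).congr'
      (hev1.mono fun r hr => (hfR r hr).symm)
  · rw [hfR r hr, ← htz]
    exact ⟨lt_seriesRatio hA hA1 ht0 ht1 ht (hsq r hr),
      seriesRatio_lt_one hA hA1 ht0 ht1 (hsq r hr)⟩
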